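/- arXiv:1406.1384 — 4 statements merged into one kernel-verified Lean document; each statement's English description precedes it below -/
import Mathlib

section
/- For any family of parafermion generators and any multi-index I = (n_1,…,n_L) with entries in {0,…,n−1}, the ordered product ϑ(c_1)^{n_1} ϑ(c_2)^{n_2} ⋯ ϑ(c_L)^{n_L}, where ϑ(c_j) := c_{L−j+1}^{n−1}, equals ω^{−I∘I} C_{ϑ(I^c)}. In other words, c_L^{(n−1)n_1} c_{L−1}^{(n−1)n_2} ⋯ c_1^{(n−1)n_L} = ω^{−I∘I} C_{ϑ(I^c)}. -/
open Matrix

/-- The primitive n-th root of unity `ω = exp(2πi/n)`. -/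
noncomputable def pfOmega (n : ℕ) : ℂ := Complex.exp (2 * Real.pi * Complex.I / n)

/-- `ω^{m/2} = exp(πim/n)`, the canonical square root of `ω^m`. -/
noncomputable def pfHalf (n : ℕ) (m : ℤ) : ℂ := Complex.exp (Real.pi * Complex.I * m / n)

/-- The ordered monomial `C_I = c 0 ^ I 0 * c 1 ^ I 1 * ⋯ * c (L-1) ^ I (L-1)`. -/
noncomputable def pfMonomial {L N : ℕ} (c : Fin L → Matrix (Fin N) (Fin N) ℂ)
    (I : Fin L → ℕ) : Matrix (Fin N) (Fin N) ℂ :=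
  (List.ofFn fun j => c j ^ I j).prod

/-- `I ∘ I' = Σ_{j < j'} I j * I' j'`. -/
def pfCirc {k : ℕ} (I I' : Fin k → ℕ) : ℕ :=
  ∑ j : Fin k, ∑ j' : Fin k, if j < j' then I j * I' j' else 0

/-- Total degree `|I| = Σ_j I j`. -/
def pfDeg {k : ℕ} (I : Fin k → ℕ) : ℕ := ∑ j, I j

/-- The complement multi-index `I^c = ((n - I j) mod n)_j`. -/
def pfComp (n : ℕ) {L : ℕ} (I : Fin L → ℕ) : Fin L → ℕ := fun j => (n - I j) % n

/-- The reflected multi-index `ϑI`, reversing the order of the entries. -/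
def pfThetaIdx {L : ℕ} (I : Fin L → ℕ) : Fin L → ℕ := fun j => I j.rev

/-- The reflected monomial `ϑ(C_I) = ω^{-I∘I} C_{ϑ(I^c)}`. -/
noncomputable def pfRefl (n : ℕ) {L N : ℕ} (c : Fin L → Matrix (Fin N) (Fin N) ℂ)
    (I : Fin L → ℕ) : Matrix (Fin N) (Fin N) ℂ :=
  pfOmega n ^ (-(pfCirc I I : ℤ)) • pfMonomial c (pfThetaIdx (pfComp n I))

/-- `c` is a family of parafermion generators of order `n`:
each `c j` is unitary, `c j ^ n = 1`, and `c j * c j' = ω • (c j' * c j)` for `j < j'`. -/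
def IsParafermion (n : ℕ) {L N : ℕ} (c : Fin L → Matrix (Fin N) (Fin N) ℂ) : Prop :=
  (∀ j, (c j)ᴴ * c j = 1 ∧ c j * (c j)ᴴ = 1) ∧
  (∀ j, c j ^ n = 1) ∧
  (∀ j j' : Fin L, j < j' → c j * c j' = pfOmega n • (c j' * c j))

/-- `I` is supported in `Λ₋ = {0, …, L/2 - 1}` (sites `1, …, L/2` in 1-based labels). -/
def pfSuppNeg {L : ℕ} (I : Fin L → ℕ) : Prop := ∀ j : Fin L, L / 2 ≤ j.val → I j = 0

/-- `I` is supported in `Λ₊ = {L/2, …, L-1}` (sites `L/2 + 1, …, L` in 1-based labels). -/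
def pfSuppPos {L : ℕ} (I : Fin L → ℕ) : Prop := ∀ j : Fin L, j.val < L / 2 → I j = 0

/-- The element `Σ_I a_I C_I` determined by a coefficient function `a`. -/
noncomputable def pfSum {L N : ℕ} (n : ℕ) (c : Fin L → Matrix (Fin N) (Fin N) ℂ)
    (a : (Fin L → Fin n) → ℂ) : Matrix (Fin N) (Fin N) ℂ :=
  ∑ I : Fin L → Fin n, a I • pfMonomial c fun j => (I j : ℕ)

/-- The reflection `ϑ(Σ_I a_I C_I) = Σ_I conj (a_I) ϑ(C_I)`. -/
noncomputable def pfSumRefl {L N : ℕ} (n : ℕ) (c : Fin L → Matrix (Fin N) (Fin N) ℂ)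
    (a : (Fin L → Fin n) → ℂ) : Matrix (Fin N) (Fin N) ℂ :=
  ∑ I : Fin L → Fin n, (starRingEnd ℂ) (a I) • pfRefl n c fun j => (I j : ℕ)

/-- Coefficients of an element of the observable algebra `𝔄₋ⁿ`: supported on
multi-indices supported in `Λ₋` with total degree divisible by `n`. -/
def pfObsNegCoeff {L : ℕ} (n : ℕ) (a : (Fin L → Fin n) → ℂ) : Prop :=
  ∀ I : Fin L → Fin n,
    ¬ (pfSuppNeg (fun j => (I j : ℕ)) ∧ n ∣ pfDeg (fun j => (I j : ℕ))) → a I = 0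

/-- Coefficients of an element of the observable algebra `𝔄₊ⁿ`. -/
def pfObsPosCoeff {L : ℕ} (n : ℕ) (a : (Fin L → Fin n) → ℂ) : Prop :=
  ∀ I : Fin L → Fin n,
    ¬ (pfSuppPos (fun j => (I j : ℕ)) ∧ n ∣ pfDeg (fun j => (I j : ℕ))) → a I = 0

/-- The cross-plane interaction
`H₀ = Σ_I (-1)^{|I|+1} ω^{|I|²/2} J_I C_I ϑ(C_I)` determined by couplings `J`. -/
noncomputable def pfH0 {L N : ℕ} (n : ℕ) (c : Fin L → Matrix (Fin N) (Fin N) ℂ)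
    (J : (Fin L → Fin n) → ℝ) : Matrix (Fin N) (Fin N) ℂ :=
  ∑ I : Fin L → Fin n,
    ((-1 : ℂ) ^ (pfDeg (fun j => (I j : ℕ)) + 1) *
        pfHalf n ((pfDeg (fun j => (I j : ℕ)) : ℤ) ^ 2) * (J I : ℂ)) •
      (pfMonomial c (fun j => (I j : ℕ)) * pfRefl n c fun j => (I j : ℕ))

lemma reverse_ofFn_eq_ofFn_rev {α : Type*} {k : ℕ} (f : Fin k → α) :
    (List.ofFn f).reverse = List.ofFn fun j => f j.rev := by
  refine List.ext_getElem (by simp) fun i h₁ h₂ => ?_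
  simp only [List.getElem_reverse, List.getElem_ofFn, List.length_ofFn]
  congr 1
  ext
  simp only [Fin.val_rev]
  omega

section QCommute

variable {R A : Type*} [CommRing R] [Ring A] [Algebra R A]

/-- If `x * y = q • (y * x)` then `x * y ^ b = q ^ b • (y ^ b * x)`. -/
lemma mul_pow_of_qcommute {q : R} {x y : A} (h : x * y = q • (y * x)) (b : ℕ) :
    x * y ^ b = q ^ b • (y ^ b * x) := by
  induction b with
  | zero => simp
  | succ b ih =>
    rw [pow_succ, ← mul_assoc, ih, smul_mul_assoc, mul_assoc, h, mul_smul_comm, smul_smul,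
      mul_assoc, pow_succ]

/-- If `x * y = q • (y * x)` then `x ^ a * y = q ^ a • (y * x ^ a)`. -/
lemma pow_mul_of_qcommute {q : R} {x y : A} (h : x * y = q • (y * x)) (a : ℕ) :
    x ^ a * y = q ^ a • (y * x ^ a) := by
  induction a with
  | zero => simp
  | succ a ih =>
    rw [pow_succ, mul_assoc, h, mul_smul_comm, ← mul_assoc, ih, smul_mul_assoc, smul_smul,
      mul_assoc, pow_succ, mul_comm q]

lemma pow_mul_pow_of_qcommute {q : R} {x y : A} (h : x * y = q • (y * x)) (a b : ℕ) :
    x ^ a * y ^ b = q ^ (a * b) • (y ^ b * x ^ a) := by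
  rw [mul_pow_of_qcommute (pow_mul_of_qcommute h a), pow_mul]

lemma mul_reverse_ofFn_prod_of_qcommute {q : R} {x : A} {k : ℕ} (f : Fin k → A) (m : Fin k → ℕ)
    (h : ∀ j, x * f j = q ^ m j • (f j * x)) :
    x * (List.ofFn f).reverse.prod = q ^ (∑ j, m j) • ((List.ofFn f).reverse.prod * x) := by
  induction k with
  | zero => simp
  | succ k ih =>
    simp only [List.ofFn_succ, List.reverse_cons, List.prod_append, List.prod_singleton]
    rw [← mul_assoc, ih (fun j => f j.succ) (fun j => m j.succ) fun j => h j.succ,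
      smul_mul_assoc, mul_assoc, h 0, mul_smul_comm, smul_smul, Fin.sum_univ_succ, ← pow_add,
      add_comm, mul_assoc]

/-- Reversing an ordered monomial in `q`-commuting generators produces the factor
`q ^ (I ∘ I)`. -/
lemma ofFn_pow_prod_eq_reverse_of_qcommute {q : R} {k : ℕ} (d : Fin k → A)
    (h : ∀ j j', j < j' → d j * d j' = q • (d j' * d j)) (I : Fin k → ℕ) :
    (List.ofFn fun j => d j ^ I j).prod
      = q ^ pfCirc I I • (List.ofFn fun j => d j ^ I j).reverse.prod := by
  induction k with
  | zero => simp [pfCirc]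
  | succ k ih =>
    have hcirc : pfCirc I I = (∑ j : Fin k, I 0 * I j.succ)
        + pfCirc (fun j => I j.succ) (fun j => I j.succ) := by
      simp [pfCirc, Fin.sum_univ_succ]
    simp only [List.ofFn_succ, List.reverse_cons, List.prod_append, List.prod_cons,
      List.prod_nil, mul_one]
    rw [ih (fun j => d j.succ) (fun j j' hj => h _ _ (Fin.succ_lt_succ_iff.mpr hj))
        (fun j => I j.succ), mul_smul_comm,
      mul_reverse_ofFn_prod_of_qcommute (q := q) _ (fun j => I 0 * I j.succ)
        fun j => pow_mul_pow_of_qcommute (h 0 j.succ (Fin.succ_pos j)) _ _,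
      smul_smul, hcirc, pow_add, mul_comm (q ^ _)]

end QCommute

lemma pfOmega_pow_self {n : ℕ} (hn : n ≠ 0) : pfOmega n ^ n = 1 :=
  (Complex.isPrimitiveRoot_exp n hn).pow_eq_one

lemma pfOmega_ne_zero (n : ℕ) : pfOmega n ≠ 0 := Complex.exp_ne_zero _

/-- If `x ^ n = 1` then `x ^ (n - 1)` acts as the inverse of `x`. -/
lemma pow_pred_pow_eq_of_pow_eq_one {M : Type*} [Monoid M] {x : M} {n a : ℕ} (hx : x ^ n = 1)
    (ha : a < n) : (x ^ (n - 1)) ^ a = x ^ ((n - a) % n) := by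
  have hexp : (n - 1) * a + n = n * a + (n - a) := by
    obtain ⟨m, rfl⟩ : ∃ m, n = a + m := ⟨n - a, by omega⟩
    obtain ⟨p, rfl⟩ : ∃ p, m = p + 1 := ⟨m - 1, by omega⟩
    have h₁ : a + (p + 1) - 1 = a + p := by omega
    have h₂ : a + (p + 1) - a = p + 1 := by omega
    rw [h₁, h₂]
    ring
  calc (x ^ (n - 1)) ^ a = x ^ ((n - 1) * a + n) := by rw [pow_add, hx, mul_one, pow_mul]
    _ = x ^ (n - a) := by rw [hexp, pow_add, pow_mul, hx, one_pow, one_mul]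
    _ = x ^ ((n - a) % n) := pow_eq_pow_mod _ hx

/-- the ordered product `ϑ(c_1)^{n_1} ⋯ ϑ(c_L)^{n_L}`, where
`ϑ(c_j) = c_{L-j+1}^{n-1}`, equals `ω^{-I∘I} C_{ϑ(I^c)}`. -/
theorem stmt_2 (n L N : ℕ) (hn : 2 ≤ n) (hL : 2 ≤ L) (hLeven : Even L) (hN : 1 ≤ N)
    (c : Fin L → Matrix (Fin N) (Fin N) ℂ) (hc : IsParafermion n c)
    (I : Fin L → ℕ) (hI : ∀ j, I j < n) :
    (List.ofFn fun j : Fin L => (c j.rev ^ (n - 1)) ^ I j).prod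
      = pfOmega n ^ (-(pfCirc I I : ℤ)) • pfMonomial c (pfThetaIdx (pfComp n I)) := by
  obtain ⟨-, hpow, hcomm⟩ := hc
  have hω : pfOmega n ^ ((n - 1) * (n - 1)) = pfOmega n := by
    have hn1 : (n - 1) * (n - 1) = n * (n - 2) + 1 := by
      obtain ⟨m, rfl⟩ := Nat.exists_eq_add_of_le' hn
      simp only [Nat.add_sub_cancel, show m + 2 - 1 = m + 1 by omega]
      ring
    rw [hn1, pow_succ, pow_mul, pfOmega_pow_self (by omega), one_pow, one_mul]
  have hd : ∀ j j' : Fin L, j < j' → c j.rev ^ (n - 1) * c j'.rev ^ (n - 1)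
      = (pfOmega n)⁻¹ • (c j'.rev ^ (n - 1) * c j.rev ^ (n - 1)) := by
    intro j j' hj
    rw [pow_mul_pow_of_qcommute (hcomm j'.rev j.rev (Fin.rev_lt_rev.mpr hj)), hω, smul_smul,
      inv_mul_cancel₀ (pfOmega_ne_zero n), one_smul]
  rw [ofFn_pow_prod_eq_reverse_of_qcommute _ hd, inv_pow, _root_.zpow_neg, zpow_natCast]
  rw [reverse_ofFn_eq_ofFn_rev]
  simp only [pfMonomial, pfThetaIdx, pfComp, Fin.rev_rev,
    pow_pred_pow_eq_of_pow_eq_one (hpow _) (hI _)]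
end

section
/- For any family of parafermion generators and any multi-index I = (n_1,…,n_L) with entries in {0,…,n−1} that is not identically zero, the trace of the ordered monomial vanishes: Tr(C_I) = 0. -/
open Matrix

theorem pfOmega_isPrimitiveRoot {n : ℕ} (hn : n ≠ 0) : IsPrimitiveRoot (pfOmega n) n :=
  Complex.isPrimitiveRoot_exp n hn

theorem mul_pow_eq_smul_of_mul_eq_smul {R A : Type*} [CommMonoid R] [Monoid A] [MulAction R A]
    [IsScalarTower R A A] [SMulCommClass R A A] {q : R} {a b : A} (h : a * b = q • (b * a))
    (m : ℕ) : a * b ^ m = q ^ m • (b ^ m * a) := by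
  induction m with
  | zero => simp
  | succ m ih =>
    rw [pow_succ, ← mul_assoc, ih, smul_mul_assoc, mul_assoc, h, mul_smul_comm, smul_smul,
      ← pow_succ, ← mul_assoc]

theorem mul_list_prod_eq_smul {R A ι : Type*} [CommMonoid R] [Monoid A] [MulAction R A]
    [IsScalarTower R A A] [SMulCommClass R A A] {q : ι → R} {a : A} {b : ι → A}
    (h : ∀ i, a * b i = q i • (b i * a)) (l : List ι) :
    a * (l.map b).prod = (l.map q).prod • ((l.map b).prod * a) := by
  induction l with
  | nil => simp
  | cons i l ih =>
    rw [List.map_cons, List.map_cons, List.prod_cons, List.prod_cons, ← mul_assoc, h,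
      smul_mul_assoc, mul_assoc, ih, mul_smul_comm, smul_smul, ← mul_assoc]

/-- The exponent of `ω` in the exchange relation of `c k` and `c j`. -/
def pfSign {L : ℕ} (k j : Fin L) : ℤ := if k < j then 1 else if j < k then -1 else 0

theorem IsParafermion.mul_eq_smul {n L N : ℕ} {c : Fin L → Matrix (Fin N) (Fin N) ℂ}
    (hc : IsParafermion n c) (hn : n ≠ 0) (k j : Fin L) :
    c k * c j = pfOmega n ^ pfSign k j • (c j * c k) := by
  have hω := (pfOmega_isPrimitiveRoot hn).ne_zero hn
  rcases lt_trichotomy k j with h | rfl | h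
  · simpa [pfSign, h] using hc.2.2 k j h
  · simp [pfSign]
  · rw [hc.2.2 j k h, smul_smul]
    simp [pfSign, h, h.not_gt, hω]

theorem IsParafermion.mul_monomial {n L N : ℕ} {c : Fin L → Matrix (Fin N) (Fin N) ℂ}
    (hc : IsParafermion n c) (hn : n ≠ 0) (I : Fin L → ℕ) (k : Fin L) :
    c k * pfMonomial c I = pfOmega n ^ (∑ j, pfSign k j * I j) • (pfMonomial c I * c k) := by
  have hω := (pfOmega_isPrimitiveRoot hn).ne_zero hn
  have key := mul_list_prod_eq_smul
    (fun j => mul_pow_eq_smul_of_mul_eq_smul (hc.mul_eq_smul hn k j) (I j)) (List.finRange L)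
  have hq : ((List.finRange L).map fun j => (pfOmega n ^ pfSign k j) ^ I j).prod
      = pfOmega n ^ (∑ j, pfSign k j * I j) := by
    rw [← List.ofFn_eq_map, List.prod_ofFn]
    simp only [← zpow_natCast, ← _root_.zpow_mul]
    induction (Finset.univ : Finset (Fin L)) using Finset.induction_on with
    | empty => simp
    | insert i s hi ih => rw [Finset.prod_insert hi, Finset.sum_insert hi, ih, zpow_add₀ hω]
  rwa [hq, ← List.ofFn_eq_map] at key

theorem trace_eq_zero_of_mul_eq_smul {ι K : Type*} [Fintype ι] [DecidableEq ι] [Field K]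
    {u v M : Matrix ι ι K} {q : K} (huv : u * v = 1) (hq : q ≠ 1)
    (h : u * M = q • (M * u)) : M.trace = 0 := by
  have key : M.trace = q * M.trace := by
    calc M.trace = (u * M * v).trace := by
          rw [Matrix.trace_mul_comm, ← mul_assoc, mul_eq_one_comm.mp huv, one_mul]
      _ = q * M.trace := by
          rw [h, Matrix.smul_mul, Matrix.trace_smul, mul_assoc, huv, mul_one, smul_eq_mul]
  have : (1 - q) * M.trace = 0 := by linear_combination key
  exact (mul_eq_zero.mp this).resolve_left (sub_ne_zero.mpr hq.symm)

/-- For even `L` the antisymmetric matrix `pfSign` is injective over every ring. -/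
theorem eq_zero_of_sum_pfSign_mul_eq_zero {R : Type*} [CommRing R] {L : ℕ} (hL : Even L)
    {x : Fin L → R} (h : ∀ k, ∑ j, (pfSign k j : R) * x j = 0) : x = 0 := by
  set S : ℕ → R := fun k => ∑ j : Fin L, if j.val < k then x j else 0 with hS
  have hdiff (k : Fin L) : S (k + 1) = S k + x k := by
    have : x k = ∑ j : Fin L, if j = k then x j else 0 := by simp
    rw [this, hS, ← Finset.sum_add_distrib]
    refine Finset.sum_congr rfl fun j _ => ?_
    simp only [Fin.ext_iff]
    split_ifs <;> first | omega | simp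
  have hsum (k : Fin L) : S (k + 1) = S L - S k := by
    have : S L - S (k + 1) - S k = ∑ j, (pfSign k j : R) * x j := by
      rw [hS, ← Finset.sum_sub_distrib, ← Finset.sum_sub_distrib]
      refine Finset.sum_congr rfl fun j _ => ?_
      have := j.isLt
      simp only [pfSign, Fin.lt_def]
      split_ifs <;> first | omega | simp
    rw [h k] at this
    linear_combination -this
  have hzero : S 0 = 0 := by simp [hS]
  have heven (m : ℕ) (hm : 2 * m ≤ L) : S (2 * m) = 0 := by
    induction m with
    | zero => exact hzero
    | succ m ih =>
      have h₁ := hsum ⟨2 * m, by omega⟩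
      have h₂ := hsum ⟨2 * m + 1, by omega⟩
      simp only at h₁ h₂
      rw [show 2 * (m + 1) = 2 * m + 1 + 1 by ring, h₂, h₁, ih (by omega)]
      ring
  have htotal : S L = 0 := by
    obtain ⟨m, rfl⟩ := hL
    simpa [two_mul] using heven m (by omega)
  have hall (k : ℕ) (hk : k ≤ L) : S k = 0 := by
    induction k with
    | zero => exact hzero
    | succ k ih => simpa [htotal, ih (by omega)] using hsum ⟨k, hk⟩
  funext k
  simpa [hall k k.isLt.le, hall (k + 1) k.isLt] using (hdiff k).symm

/-- if the multi-index `I` (with entries in `{0, …, n-1}`) is not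
identically zero, then `Tr (C_I) = 0`. -/
theorem stmt_8 (n L N : ℕ) (hn : 2 ≤ n) (hL : 2 ≤ L) (hLeven : Even L) (hN : 1 ≤ N)
    (c : Fin L → Matrix (Fin N) (Fin N) ℂ) (hc : IsParafermion n c)
    (I : Fin L → ℕ) (hI : ∀ j, I j < n) (hne : ∃ j, I j ≠ 0) :
    Matrix.trace (pfMonomial c I) = 0 := by
  have hn0 : n ≠ 0 := by omega
  by_contra htr
  have hdvd (k : Fin L) : (n : ℤ) ∣ ∑ j, pfSign k j * I j := by
    rw [← (pfOmega_isPrimitiveRoot hn0).zpow_eq_one_iff_dvd]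
    by_contra hq
    exact htr (trace_eq_zero_of_mul_eq_smul (hc.1 k).2 hq (hc.mul_monomial hn0 I k))
  have hx : (fun j => (I j : ZMod n)) = 0 := by
    refine eq_zero_of_sum_pfSign_mul_eq_zero hLeven fun k => ?_
    have := (ZMod.intCast_zmod_eq_zero_iff_dvd _ n).mpr (hdvd k)
    simpa using this
  obtain ⟨j, hj⟩ := hne
  have hj' : n ∣ I j := (ZMod.natCast_eq_zero_iff _ _).mp (congrFun hx j)
  exact hj (Nat.eq_zero_of_dvd_of_lt hj' (hI j))
end

section
/- For any family of parafermion generators c_1,…,c_L ∈ M_N(ℂ), the n^L ordered monomials C_I, as I ranges over all multi-indices (n_1,…,n_L) with 0 ≤ n_j ≤ n−1, are linearly independent in M_N(ℂ). -/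
open Matrix

/-- Joint eigenvectors whose eigenvalues separate the indices are linearly independent. -/
theorem linearIndependent_of_separating_eigenvalues {ι κ K V : Type*} [Field K] [AddCommGroup V]
    [Module K V] (T : κ → V →ₗ[K] V) (v : ι → V) (μ : κ → ι → K)
    (hT : ∀ k i, T k (v i) = μ k i • v i) (hv : ∀ i, v i ≠ 0)
    (hμ : ∀ i j, (∀ k, μ k i = μ k j) → i = j) : LinearIndependent K v := by
  classical
  rw [linearIndependent_iff']
  intro s
  induction s using Finset.induction_on with
  | empty => simp
  | insert a s ha ih =>
    intro g hg
    have hs : ∀ i ∈ s, g i = 0 := by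
      intro i hi
      obtain ⟨k, hk⟩ : ∃ k, μ k i ≠ μ k a := by
        by_contra! h
        exact ha (hμ i a h ▸ hi)
      have h : ∑ j ∈ s, (g j * (μ k j - μ k a)) • v j = 0 := by
        have h1 := congrArg (fun x => T k x - μ k a • x) hg
        rw [Finset.sum_insert ha] at h1
        simp only [map_add, map_sum, map_smul, hT, smul_add, Finset.smul_sum, map_zero, smul_zero,
          sub_zero] at h1
        rw [smul_comm (g a), add_sub_add_left_eq_sub, ← Finset.sum_sub_distrib] at h1
        rw [← h1]
        refine Finset.sum_congr rfl fun j _ => ?_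
        module
      exact (mul_eq_zero.mp (ih _ h i hi)).resolve_right (sub_ne_zero.mpr hk)
    rw [Finset.sum_insert ha, Finset.sum_eq_zero fun i hi => by rw [hs i hi, zero_smul],
      add_zero] at hg
    intro i hi
    rcases Finset.mem_insert.mp hi with rfl | hi
    · exact (smul_eq_zero.mp hg).resolve_right (hv i)
    · exact hs i hi

/-- Scalar commutation relations with the factors multiply to one with the product. -/
theorem mul_prod_ofFn_of_mul_eq_smul {R A : Type*} [CommSemiring R] [Semiring A] [Algebra R A]
    (a : A) {L : ℕ} (f : Fin L → A) (s : Fin L → R) (h : ∀ j, a * f j = s j • (f j * a)) :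
    a * (List.ofFn f).prod = (∏ j, s j) • ((List.ofFn f).prod * a) := by
  induction L with
  | zero => simp
  | succ L ih =>
    rw [List.ofFn_succ, List.prod_cons, Fin.prod_univ_succ, ← mul_assoc, h, smul_mul_assoc,
      mul_assoc (f 0), ih (fun j => f j.succ) (fun j => s j.succ) fun j => h _,
      mul_smul_comm, smul_smul, mul_assoc]

theorem mul_pow_of_mul_eq_smul {R A : Type*} [CommSemiring R] [Semiring A] [Algebra R A]
    {a b : A} {s : R} (h : a * b = s • (b * a)) (m : ℕ) :
    a * b ^ m = s ^ m • (b ^ m * a) := by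
  induction m with
  | zero => simp
  | succ m ih =>
    rw [pow_succ, ← mul_assoc, ih, smul_mul_assoc, mul_assoc, h, mul_smul_comm, smul_smul,
      pow_succ, mul_assoc]

/-- The sign of `j - k`. -/
def orderSign {L : ℕ} (k j : Fin L) : ℤ := if k < j then 1 else if j < k then -1 else 0

/-- The skew form with entries `orderSign` is nondegenerate in even dimension over any ring. -/
theorem eq_zero_of_sum_orderSign_mul_eq_zero {R : Type*} [CommRing R] {L : ℕ} (hL : Even L)
    (d : Fin L → R) (h : ∀ k, ∑ j, (orderSign k j : R) * d j = 0) (j : Fin L) : d j = 0 := by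
  obtain ⟨M, rfl⟩ : ∃ M, L = M + 1 := ⟨L - 1, by have := j.pos; omega⟩
  have hstep : ∀ i : Fin M, d i.succ = - d i.castSucc := by
    intro i
    have h1 : ∑ j, ((orderSign i.castSucc j : R) * d j - (orderSign i.succ j : R) * d j) = 0 := by
      rw [Finset.sum_sub_distrib, h, h, sub_zero]
    have h2 : ∀ j, (orderSign i.castSucc j : R) * d j - (orderSign i.succ j : R) * d j
        = (if j = i.castSucc then d j else 0) + (if j = i.succ then d j else 0) := by
      intro j
      simp only [orderSign, Fin.lt_def, Fin.ext_iff, Fin.val_castSucc, Fin.val_succ]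
      rcases lt_trichotomy (j : ℕ) i with hj | hj | hj
      · have e1 : ¬ (i : ℕ) < j := by omega
        have e2 : ¬ (i : ℕ) + 1 < j := by omega
        have e3 : (j : ℕ) < i + 1 := by omega
        have e4 : (j : ℕ) ≠ i := by omega
        have e5 : (j : ℕ) ≠ i + 1 := by omega
        simp [*]
      · simp [hj]
      · rcases eq_or_ne (j : ℕ) (i + 1) with hj' | hj'
        · simp [hj']
        · have e2 : (i : ℕ) + 1 < j := by omega
          have e4 : (j : ℕ) ≠ i := by omega
          simp [*]
    simp only [h2, Finset.sum_add_distrib, Finset.sum_ite_eq', Finset.mem_univ, if_true] at h1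
    linear_combination h1
  have hpow : ∀ i : Fin (M + 1), d i = (-1) ^ (i : ℕ) * d 0 := by
    intro i
    induction i using Fin.induction with
    | zero => simp
    | succ i ih => rw [hstep, ih, Fin.val_succ, Fin.val_castSucc, pow_succ]; ring
  have h0 : d 0 = 0 := by
    have hsum : ∑ i : Fin (M + 1), (-1 : R) ^ (i : ℕ) = 0 := by
      rw [Fin.sum_neg_one_pow, if_pos hL]
    have h1 := h 0
    rw [Fin.sum_univ_succ] at h1 hsum
    have h2 : ∀ i : Fin M,
        (orderSign 0 i.succ : R) * d i.succ = (-1) ^ ((i.succ : Fin (M + 1)) : ℕ) * d 0 := by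
      intro i
      rw [hpow i.succ]
      simp [orderSign]
    simp only [h2, ← Finset.sum_mul] at h1
    simp only [orderSign, lt_irrefl, if_false, Int.cast_zero, Fin.val_zero, pow_zero] at h1 hsum
    linear_combination hsum * d 0 - h1
  rw [hpow, h0, mul_zero]

theorem IsParafermion.mul_eq_zpow_orderSign_smul {n L N : ℕ} (hn : n ≠ 0)
    {c : Fin L → Matrix (Fin N) (Fin N) ℂ} (hc : IsParafermion n c) (k j : Fin L) :
    c k * c j = pfOmega n ^ orderSign k j • (c j * c k) := by
  rcases lt_trichotomy k j with h | rfl | h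
  · simpa [orderSign, h] using hc.2.2 k j h
  · simp [orderSign]
  · rw [hc.2.2 j k h, smul_smul]
    simp [orderSign, h, h.not_gt, (pfOmega_isPrimitiveRoot hn).ne_zero hn]

theorem IsParafermion.mul_pfMonomial {n L N : ℕ} (hn : n ≠ 0)
    {c : Fin L → Matrix (Fin N) (Fin N) ℂ} (hc : IsParafermion n c) (k : Fin L) (I : Fin L → ℕ) :
    c k * pfMonomial c I =
      pfOmega n ^ (∑ j, orderSign k j * (I j : ℤ)) • (pfMonomial c I * c k) := by
  rw [pfMonomial, mul_prod_ofFn_of_mul_eq_smul (c k) _ _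
    fun j => mul_pow_of_mul_eq_smul (hc.mul_eq_zpow_orderSign_smul hn k j) (I j)]
  congr 1
  have h0 := (pfOmega_isPrimitiveRoot hn).ne_zero hn
  induction (Finset.univ : Finset (Fin L)) using Finset.induction_on with
  | empty => simp
  | insert a s ha ih =>
    rw [Finset.prod_insert ha, Finset.sum_insert ha, zpow_add₀ h0, ih, _root_.zpow_mul, zpow_natCast]

theorem IsParafermion.isUnit_pfMonomial {n L N : ℕ} {c : Fin L → Matrix (Fin N) (Fin N) ℂ}
    (hc : IsParafermion n c) (I : Fin L → ℕ) : IsUnit (pfMonomial c I) := by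
  refine List.prod_isUnit fun x hx => ?_
  obtain ⟨j, rfl⟩ := List.mem_ofFn.mp hx
  exact IsUnit.pow _ ⟨⟨c j, (c j)ᴴ, (hc.1 j).2, (hc.1 j).1⟩, rfl⟩

/-- the `n^L` ordered monomials `C_I` are linearly independent. -/
theorem stmt_9 (n L N : ℕ) (hn : 2 ≤ n) (hL : 2 ≤ L) (hLeven : Even L) (hN : 1 ≤ N)
    (c : Fin L → Matrix (Fin N) (Fin N) ℂ) (hc : IsParafermion n c) :
    LinearIndependent ℂ
      (fun I : Fin L → Fin n => pfMonomial c fun j => (I j : ℕ)) := by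
  have hn0 : n ≠ 0 := by omega
  have : NeZero N := ⟨by omega⟩
  have hω := pfOmega_isPrimitiveRoot hn0
  refine linearIndependent_of_separating_eigenvalues
    (fun k => LinearMap.mulLeft ℂ (c k) ∘ₗ LinearMap.mulRight ℂ (c k)ᴴ) _
    (fun k I => pfOmega n ^ (∑ j, orderSign k j * ((I j : ℕ) : ℤ))) ?_ ?_ ?_
  · intro k I
    simp only [LinearMap.comp_apply, LinearMap.mulLeft_apply, LinearMap.mulRight_apply]
    rw [← mul_assoc, hc.mul_pfMonomial hn0, smul_mul_assoc, mul_assoc, (hc.1 k).2, mul_one]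
  · exact fun I => (hc.isUnit_pfMonomial _).ne_zero
  · intro I J h
    have hzero := eq_zero_of_sum_orderSign_mul_eq_zero (R := ZMod n) hLeven
      (fun j => (((I j : ℕ) : ℤ) - ((J j : ℕ) : ℤ) : ℤ)) fun k => by
        have h1 : pfOmega n ^ (∑ j, orderSign k j * (((I j : ℕ) : ℤ) - ((J j : ℕ) : ℤ))) = 1 := by
          simp only [mul_sub, Finset.sum_sub_distrib]
          rw [zpow_sub₀ (hω.ne_zero hn0), h k, div_self (zpow_ne_zero _ (hω.ne_zero hn0))]
        have h2 := (ZMod.intCast_zmod_eq_zero_iff_dvd _ n).mpr ((hω.zpow_eq_one_iff_dvd _).mp h1)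
        simpa using h2
    funext j
    have hj : (((I j : ℕ) : ℤ) - ((J j : ℕ) : ℤ) : ℤ) = 0 :=
      Int.eq_zero_of_abs_lt_dvd ((ZMod.intCast_zmod_eq_zero_iff_dvd _ n).mp (hzero j)) (by
        have := (I j).isLt
        have := (J j).isLt
        rw [abs_lt]
        omega)
    exact Fin.ext (by omega)
end

section
/- (General Rearrangement.) Let A, B_1, …, B_k ∈ 𝔄_-^n and let I^{(1)}, …, I^{(k)} be multi-indices supported in Λ_-. Then A ϑ(A) C_{I^{(1)}} ϑ(C_{I^{(1)}}) B_1 ϑ(B_1) C_{I^{(2)}} ϑ(C_{I^{(2)}}) B_2 ϑ(B_2) ⋯ C_{I^{(k)}} ϑ(C_{I^{(k)}}) B_k ϑ(B_k) = ω^{Σ_{1≤j<j'≤k} |I^{(j)}|·|I^{(j')}|} · A D ϑ(A) ϑ(D), where D = C_{I^{(1)}} B_1 C_{I^{(2)}} B_2 ⋯ C_{I^{(k)}} B_k and ϑ(D) = ϑ(C_{I^{(1)}}) ϑ(B_1) ϑ(C_{I^{(2)}}) ϑ(B_2) ⋯ ϑ(C_{I^{(k)}}) ϑ(B_k). -/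
open Matrix

lemma pfOmega_pow_of_dvd {n m : ℕ} (hn : n ≠ 0) (h : n ∣ m) : pfOmega n ^ m = 1 := by
  obtain ⟨t, rfl⟩ := h
  rw [pow_mul, pfOmega_pow_self hn, one_pow]

/-- `x` and `y` commute up to the scalar `z`: `x * y = z • (y * x)`. -/
def ScalarCommute {R : Type*} [Ring R] [Algebra ℂ R] (z : ℂ) (x y : R) : Prop :=
  x * y = z • (y * x)

namespace ScalarCommute

variable {R : Type*} [Ring R] [Algebra ℂ R] {z w : ℂ} {x x' y y' : R}

lemma iff_commute : ScalarCommute 1 x y ↔ Commute x y := by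
  rw [ScalarCommute, one_smul]
  rfl

lemma mul_left (h : ScalarCommute z x y) (h' : ScalarCommute w x' y) :
    ScalarCommute (z * w) (x * x') y := by
  unfold ScalarCommute at *
  rw [mul_assoc, h', mul_smul_comm, ← mul_assoc, h, smul_mul_assoc, smul_smul, mul_assoc,
    mul_comm w]

lemma mul_right (h : ScalarCommute z x y) (h' : ScalarCommute w x y') :
    ScalarCommute (z * w) x (y * y') := by
  unfold ScalarCommute at *
  rw [← mul_assoc, h, smul_mul_assoc, mul_assoc, h', mul_smul_comm, smul_smul, mul_assoc]

lemma one_left : ScalarCommute 1 1 y := by simp [ScalarCommute]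

lemma one_right : ScalarCommute 1 x 1 := by simp [ScalarCommute]

lemma pow_left (h : ScalarCommute z x y) (m : ℕ) : ScalarCommute (z ^ m) (x ^ m) y := by
  induction m with
  | zero => simpa using one_left
  | succ m ih => simpa only [pow_succ] using ih.mul_left h

lemma pow_right (h : ScalarCommute z x y) (m : ℕ) : ScalarCommute (z ^ m) x (y ^ m) := by
  induction m with
  | zero => simpa using one_right
  | succ m ih => simpa only [pow_succ] using ih.mul_right h

lemma smul_left (h : ScalarCommute z x y) (r : ℂ) : ScalarCommute z (r • x) y := by
  unfold ScalarCommute at *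
  rw [smul_mul_assoc, h, mul_smul_comm, smul_comm]

lemma symm_of_mul_eq_one (h : ScalarCommute z x y) (hw : w * z = 1) : ScalarCommute w y x := by
  unfold ScalarCommute at *
  rw [h, smul_smul, hw, one_smul]

lemma listProd_left {k : ℕ} {X : Fin k → R} {z : Fin k → ℂ}
    (h : ∀ i, ScalarCommute (z i) (X i) y) :
    ScalarCommute (∏ i, z i) (List.ofFn X).prod y := by
  induction k with
  | zero => simpa using one_left
  | succ k ih =>
    rw [List.ofFn_succ, List.prod_cons, Fin.prod_univ_succ]
    exact (h 0).mul_left (ih fun i => h i.succ)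

lemma listProd_right {k : ℕ} {Y : Fin k → R} {z : Fin k → ℂ}
    (h : ∀ i, ScalarCommute (z i) x (Y i)) :
    ScalarCommute (∏ i, z i) x (List.ofFn Y).prod := by
  induction k with
  | zero => simpa using one_right
  | succ k ih =>
    rw [List.ofFn_succ, List.prod_cons, Fin.prod_univ_succ]
    exact (h 0).mul_right (ih fun i => h i.succ)

end ScalarCommute

lemma pfCirc_succ {k : ℕ} (d : Fin (k + 1) → ℕ) :
    pfCirc d d = d 0 * ∑ i : Fin k, d i.succ
      + pfCirc (fun i : Fin k => d i.succ) (fun i : Fin k => d i.succ) := by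
  simp [pfCirc, Fin.sum_univ_succ, Finset.mul_sum]

/-- Interleaved products of two families whose members commute up to powers of a scalar can be
separated. -/
lemma listProd_mul_eq_smul {R : Type*} [Ring R] [Algebra ℂ R] {k : ℕ} (q : ℂ) (X Y : Fin k → R)
    (d : Fin k → ℕ) (h : ∀ i j, ScalarCommute (q ^ (d i * d j)) (Y i) (X j)) :
    (List.ofFn fun i => X i * Y i).prod
      = q ^ pfCirc d d • ((List.ofFn X).prod * (List.ofFn Y).prod) := by
  induction k with
  | zero => simp [pfCirc]
  | succ k ih =>
    have hY : ScalarCommute (q ^ (d 0 * ∑ i : Fin k, d i.succ)) (Y 0)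
        (List.ofFn fun i : Fin k => X i.succ).prod := by
      rw [Finset.mul_sum, ← Finset.prod_pow_eq_pow_sum]
      exact ScalarCommute.listProd_right fun i => h 0 i.succ
    simp only [List.ofFn_succ, List.prod_cons]
    rw [ih (fun i => X i.succ) (fun i => Y i.succ) (fun i => d i.succ)
        fun i j => h i.succ j.succ, pfCirc_succ, mul_smul_comm, mul_assoc (X 0),
      ← mul_assoc (Y 0), hY, smul_mul_assoc, mul_smul_comm, smul_smul, pow_add, mul_comm (q ^ _)]
    simp only [mul_assoc]

section Parafermion

variable {n L N : ℕ} {c : Fin L → Matrix (Fin N) (Fin N) ℂ}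

lemma IsParafermion.scalarCommute_monomial (hc : IsParafermion n c) {I J : Fin L → ℕ}
    (hI : pfSuppNeg I) (hJ : pfSuppPos J) :
    ScalarCommute (pfOmega n ^ (pfDeg I * pfDeg J)) (pfMonomial c I) (pfMonomial c J) := by
  have hpow : ∀ i j, ScalarCommute (pfOmega n ^ (I i * J j)) (c i ^ I i) (c j ^ J j) := by
    intro i j
    rcases lt_or_ge i.val (L / 2) with hi | hi
    · rcases lt_or_ge j.val (L / 2) with hj | hj
      · simpa [hJ j hj] using ScalarCommute.one_right
      · have hij : ScalarCommute (pfOmega n) (c i) (c j) :=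
          hc.2.2 i j (Fin.lt_def.2 (hi.trans_le hj))
        rw [pow_mul]
        exact (hij.pow_left _).pow_right _
    · simpa [hI i hi] using ScalarCommute.one_left
  have := ScalarCommute.listProd_left fun i => ScalarCommute.listProd_right (hpow i)
  simpa only [Finset.prod_pow_eq_pow_sum, ← Finset.mul_sum, ← Finset.sum_mul, pfDeg, pfMonomial] using this

lemma pfSuppPos_reflect {I : Fin L → ℕ} (hI : pfSuppNeg I) :
    pfSuppPos (pfThetaIdx (pfComp n I)) := by
  intro j hj
  have h : I j.rev = 0 := hI _ (by rw [Fin.val_rev]; omega)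
  simp [pfThetaIdx, pfComp, h]

lemma dvd_pfDeg_reflect_add {I : Fin L → ℕ} (hI : ∀ j, I j < n) :
    n ∣ pfDeg (pfThetaIdx (pfComp n I)) + pfDeg I := by
  have h : pfDeg (pfThetaIdx (pfComp n I)) = ∑ j, pfComp n I j :=
    Equiv.sum_comp Fin.revPerm (pfComp n I)
  rw [h, pfDeg, ← Finset.sum_add_distrib]
  refine Finset.dvd_sum fun j _ => ?_
  rw [Nat.dvd_iff_mod_eq_zero, pfComp, Nat.mod_add_mod, Nat.sub_add_cancel (hI j).le,
    Nat.mod_self]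

lemma IsParafermion.scalarCommute_refl_monomial (hc : IsParafermion n c) (hn : n ≠ 0)
    {I J : Fin L → ℕ} (hI : pfSuppNeg I) (hIn : ∀ j, I j < n) (hJ : pfSuppNeg J) :
    ScalarCommute (pfOmega n ^ (pfDeg I * pfDeg J)) (pfRefl n c I) (pfMonomial c J) := by
  refine ScalarCommute.smul_left ?_ _
  refine (hc.scalarCommute_monomial hJ (pfSuppPos_reflect hI)).symm_of_mul_eq_one ?_
  rw [mul_comm (pfDeg I), ← pow_add, ← mul_add, add_comm]
  exact pfOmega_pow_of_dvd hn ((dvd_pfDeg_reflect_add hIn).mul_left _)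

lemma IsParafermion.commute_refl_sum (hc : IsParafermion n c) (hn : n ≠ 0)
    {I : Fin L → ℕ} (hI : pfSuppNeg I) (hIn : ∀ j, I j < n) {b : (Fin L → Fin n) → ℂ}
    (hb : pfObsNegCoeff n b) : Commute (pfRefl n c I) (pfSum n c b) := by
  refine Commute.sum_right _ _ _ fun J _ => ?_
  by_cases hJ : pfSuppNeg (fun j => (J j : ℕ)) ∧ n ∣ pfDeg (fun j => (J j : ℕ))
  · refine Commute.smul_right (ScalarCommute.iff_commute.1 ?_) _
    rw [← pfOmega_pow_of_dvd hn (hJ.2.mul_left (pfDeg I))]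
    exact hc.scalarCommute_refl_monomial hn hI hIn hJ.1
  · rw [hb J hJ, zero_smul]
    exact Commute.zero_right _

lemma IsParafermion.commute_sumRefl_monomial (hc : IsParafermion n c) (hn : n ≠ 0)
    {a : (Fin L → Fin n) → ℂ} (ha : pfObsNegCoeff n a) {J : Fin L → ℕ} (hJ : pfSuppNeg J) :
    Commute (pfSumRefl n c a) (pfMonomial c J) := by
  refine Commute.sum_left _ _ _ fun I _ => ?_
  by_cases hI : pfSuppNeg (fun j => (I j : ℕ)) ∧ n ∣ pfDeg (fun j => (I j : ℕ))
  · refine Commute.smul_left (ScalarCommute.iff_commute.1 ?_) _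
    rw [← pfOmega_pow_of_dvd hn (hI.2.mul_right (pfDeg J))]
    exact hc.scalarCommute_refl_monomial hn hI.1 (fun j => (I j).isLt) hJ
  · rw [ha I hI, map_zero, zero_smul]
    exact Commute.zero_left _

lemma IsParafermion.commute_sumRefl_sum (hc : IsParafermion n c) (hn : n ≠ 0)
    {a b : (Fin L → Fin n) → ℂ} (ha : pfObsNegCoeff n a) (hb : pfObsNegCoeff n b) :
    Commute (pfSumRefl n c a) (pfSum n c b) := by
  refine Commute.sum_right _ _ _ fun J _ => ?_
  by_cases hJ : pfSuppNeg (fun j => (J j : ℕ)) ∧ n ∣ pfDeg (fun j => (J j : ℕ))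
  · exact (hc.commute_sumRefl_monomial hn ha hJ.1).smul_right _
  · rw [hb J hJ, zero_smul]
    exact Commute.zero_right _

end Parafermion

/-- General Rearrangement: for `A, B₁, …, B_k ∈ 𝔄₋ⁿ` and multi-indices
`I⁽¹⁾, …, I⁽ᵏ⁾` supported in `Λ₋`,
`A ϑ(A) Π_i (C_{I⁽ⁱ⁾} ϑ(C_{I⁽ⁱ⁾}) B_i ϑ(B_i))
  = ω^{Σ_{i<i'} |I⁽ⁱ⁾||I⁽ⁱ'⁾|} A D ϑ(A) ϑ(D)`, where
`D = Π_i (C_{I⁽ⁱ⁾} B_i)` and `ϑ(D) = Π_i (ϑ(C_{I⁽ⁱ⁾}) ϑ(B_i))`. -/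
theorem stmt_14 (n L N : ℕ) (hn : 2 ≤ n) (hL : 2 ≤ L) (hLeven : Even L) (hN : 1 ≤ N)
    (c : Fin L → Matrix (Fin N) (Fin N) ℂ) (hc : IsParafermion n c)
    (k : ℕ) (Idx : Fin k → Fin L → ℕ)
    (hIdx : ∀ i j, Idx i j < n) (hIsupp : ∀ i, pfSuppNeg (Idx i))
    (a : (Fin L → Fin n) → ℂ) (ha : pfObsNegCoeff n a)
    (b : Fin k → (Fin L → Fin n) → ℂ) (hb : ∀ i, pfObsNegCoeff n (b i)) :
    let A := pfSum n c a
    let θA := pfSumRefl n c a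
    let B := fun i : Fin k => pfSum n c (b i)
    let θB := fun i : Fin k => pfSumRefl n c (b i)
    let D := (List.ofFn fun i : Fin k => pfMonomial c (Idx i) * B i).prod
    let θD := (List.ofFn fun i : Fin k => pfRefl n c (Idx i) * θB i).prod
    A * θA *
        (List.ofFn fun i : Fin k =>
          pfMonomial c (Idx i) * pfRefl n c (Idx i) * B i * θB i).prod
      = pfOmega n ^ (pfCirc (fun i => pfDeg (Idx i)) (fun i => pfDeg (Idx i))) •
          (A * D * (θA * θD)) := by
  intro A θA B θB D θD
  have hn0 : n ≠ 0 := by omega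
  have hCB : ∀ i j, Commute (pfRefl n c (Idx i)) (B j) := fun i j =>
    hc.commute_refl_sum hn0 (hIsupp i) (hIdx i) (hb j)
  have hθAD : Commute θA D := by
    refine Commute.list_prod_right _ _ fun x hx => ?_
    obtain ⟨i, rfl⟩ := List.mem_ofFn.1 hx
    exact (hc.commute_sumRefl_monomial hn0 ha (hIsupp i)).mul_right
      (hc.commute_sumRefl_sum hn0 ha (hb i))
  have hfactor : (fun i => pfMonomial c (Idx i) * pfRefl n c (Idx i) * B i * θB i)
      = fun i => pfMonomial c (Idx i) * B i * (pfRefl n c (Idx i) * θB i) := by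
    funext i
    rw [mul_assoc (pfMonomial c (Idx i)), (hCB i i).eq]
    simp only [mul_assoc]
  have hswap : ∀ i j, ScalarCommute (pfOmega n ^ (pfDeg (Idx i) * pfDeg (Idx j)))
      (pfRefl n c (Idx i) * θB i) (pfMonomial c (Idx j) * B j) := by
    intro i j
    have h₁ := (hc.scalarCommute_refl_monomial hn0 (hIsupp i) (hIdx i) (hIsupp j)).mul_right
      (ScalarCommute.iff_commute.2 (hCB i j))
    have h₂ := ScalarCommute.iff_commute.2 ((hc.commute_sumRefl_monomial hn0 (hb i)
      (hIsupp j)).mul_right (hc.commute_sumRefl_sum hn0 (hb i) (hb j)))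
    simpa using h₁.mul_left h₂
  rw [hfactor, listProd_mul_eq_smul (pfOmega n) _ _ (fun i => pfDeg (Idx i)) hswap,
    mul_smul_comm]
  change _ • (A * θA * (D * θD)) = _
  rw [mul_assoc A, ← mul_assoc θA, hθAD.eq]
  simp only [mul_assoc]
end
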